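/- For every integer r ≥ 2, the integer identity (f(r+1) - 8·f(r)) · (r-2)! · (2r)! = 3·(5r² - 19r + 6) · (3r-4)! holds. -/

import Mathlib

/-- `f r = 2^(3r-4) - 3·∑_{j=0}^{r-3} C(3r-4, j)`; for `r ≥ 2` this is the
number of triangulations of a triangle each of whose sides is subdivided by
`r-1` points. -/
def f (r : ℕ) : ℤ :=
  2 ^ (3 * r - 4) - 3 * ∑ j ∈ Finset.range (r - 2), ((3 * r - 4).choose j : ℤ)

/-- Pascal's rule for partial row sums of binomial coefficients. -/
theorem sum_range_succ_choose_succ (n k : ℕ) :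
    ∑ j ∈ Finset.range (k + 1), ((n + 1).choose j : ℤ) =
      2 * ∑ j ∈ Finset.range k, (n.choose j : ℤ) + n.choose k := by
  induction k with
  | zero => simp
  | succ k ih =>
    rw [Finset.sum_range_succ, ih, Finset.sum_range_succ, Nat.choose_succ_succ']
    push_cast
    ring

/-- Equation (rek) of the paper: the recurrence
`f(r+1) - 8·f(r) = 3·(5r²-19r+6)·(3r-4)!/((r-2)!(2r)!)`, cleared of
denominators so as to be an identity over `ℤ`. -/
theorem f_recurrence (r : ℕ) (hr : 2 ≤ r) :
    (f (r + 1) - 8 * f r) * ((r - 2).factorial : ℤ) * ((2 * r).factorial : ℤ) =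
      3 * (5 * (r : ℤ) ^ 2 - 19 * r + 6) * ((3 * r - 4).factorial : ℤ) := by
  obtain ⟨m, rfl⟩ := Nat.exists_eq_add_of_le' hr
  have hf : f (m + 2 + 1) - 8 * f (m + 2) =
      3 * (((3 * m + 4).choose m : ℤ) + 2 * (3 * m + 3).choose m - 4 * (3 * m + 2).choose m) := by
    have h₁ := sum_range_succ_choose_succ (3 * m + 2) m
    have h₂ := sum_range_succ_choose_succ (3 * m + 3) m
    have h₃ := sum_range_succ_choose_succ (3 * m + 4) m
    have h₄ := Finset.sum_range_succ (fun j => ((3 * m + 3).choose j : ℤ)) m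
    have h₅ := Finset.sum_range_succ (fun j => ((3 * m + 4).choose j : ℤ)) m
    simp only [f, show 3 * (m + 2 + 1) - 4 = 3 * m + 4 + 1 by lia,
      show 3 * (m + 2) - 4 = 3 * m + 2 by lia, show m + 2 + 1 - 2 = m + 1 by lia,
      Nat.add_sub_cancel, pow_succ]
    linarith
  have c₁ : ((3 * m + 2).choose m : ℤ) * m.factorial * (2 * m + 2).factorial =
      (3 * m + 2).factorial := by
    have h := Nat.choose_mul_factorial_mul_factorial (show m ≤ 3 * m + 2 by lia)
    rw [show 3 * m + 2 - m = 2 * m + 2 by lia] at h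
    exact_mod_cast h
  have c₂ : ((3 * m + 3).choose m : ℤ) * m.factorial * ((2 * m + 3) * (2 * m + 2).factorial) =
      (3 * m + 3) * (3 * m + 2).factorial := by
    have h := Nat.choose_mul_factorial_mul_factorial (show m ≤ 3 * m + 3 by lia)
    rw [show 3 * m + 3 - m = 2 * m + 2 + 1 by lia, Nat.factorial_succ (2 * m + 2),
      Nat.factorial_succ (3 * m + 2)] at h
    exact_mod_cast h
  have c₃ : ((3 * m + 4).choose m : ℤ) * m.factorial *
      ((2 * m + 4) * ((2 * m + 3) * (2 * m + 2).factorial)) =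
      (3 * m + 4) * ((3 * m + 3) * (3 * m + 2).factorial) := by
    have h := Nat.choose_mul_factorial_mul_factorial (show m ≤ 3 * m + 4 by lia)
    rw [show 3 * m + 4 - m = 2 * m + 2 + 1 + 1 by lia, Nat.factorial_succ (2 * m + 2 + 1),
      Nat.factorial_succ (2 * m + 2), Nat.factorial_succ (3 * m + 3),
      Nat.factorial_succ (3 * m + 2)] at h
    exact_mod_cast h
  rw [hf, show 2 * (m + 2) = 2 * m + 2 + 1 + 1 by lia, Nat.factorial_succ (2 * m + 2 + 1),
    Nat.factorial_succ (2 * m + 2), show 3 * (m + 2) - 4 = 3 * m + 2 by lia, Nat.add_sub_cancel]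
  push_cast
  linear_combination 3 * c₃ + 6 * (2 * m + 4) * c₂ - 12 * (2 * m + 4) * (2 * m + 3) * c₁
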